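/- If Z and A are n×n matrices over R satisfying ∂Z = A·Z (entrywise), then the 2n×2n block matrices W = [[Z, δZ],[0, Z]] and B = [[A, δA],[0, A]] satisfy ∂W = B·W; that is, the prolonged solution matrix satisfies the prolonged linear differential equation. -/

import Mathlib

/-- The Leibniz rule for the entrywise application of a derivation to a matrix product. -/
theorem Matrix.map_mul_of_leibniz {R l m n : Type*} [NonUnitalNonAssocSemiring R] [Fintype m]
    (δ : R →+ R) (hmul : ∀ a b : R, δ (a * b) = a * δ b + δ a * b)
    (A : Matrix l m R) (B : Matrix m n R) :
    (A * B).map δ = A * B.map δ + A.map δ * B := by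
  ext i j
  simp [Matrix.mul_apply, hmul, Finset.sum_add_distrib]

/-- If `∂Z = A·Z`, then the prolonged solution matrix `[[Z, δZ],[0, Z]]` satisfies the
prolonged equation `∂W = [[A, δA],[0, A]]·W`, for commuting derivations `∂` and `δ`. -/
theorem stmt8 {R : Type*} [CommRing R] (par δ : R → R)
    (hpadd : ∀ a b : R, par (a + b) = par a + par b)
    (hpmul : ∀ a b : R, par (a * b) = a * par b + par a * b)
    (hdadd : ∀ a b : R, δ (a + b) = δ a + δ b)
    (hdmul : ∀ a b : R, δ (a * b) = a * δ b + δ a * b)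
    (hcomm : ∀ a : R, par (δ a) = δ (par a))
    (n : ℕ) (Z A : Matrix (Fin n) (Fin n) R)
    (hZ : Z.map par = A * Z) :
    (Matrix.fromBlocks Z (Z.map δ) 0 Z).map par =
      Matrix.fromBlocks A (A.map δ) 0 A * Matrix.fromBlocks Z (Z.map δ) 0 Z := by
  have hp0 : par 0 = 0 := (AddMonoidHom.mk' par hpadd).map_zero
  have hδZ : (Z.map δ).map par = A * Z.map δ + A.map δ * Z := calc
    (Z.map δ).map par = (Z.map par).map δ := by ext i j; exact hcomm (Z i j)
    _ = (A * Z).map δ := by rw [hZ]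
    _ = A * Z.map δ + A.map δ * Z :=
      Matrix.map_mul_of_leibniz (AddMonoidHom.mk' δ hdadd) hdmul A Z
  rw [Matrix.fromBlocks_map, Matrix.fromBlocks_multiply, hδZ, hZ, Matrix.map_zero par hp0]
  simp
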